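/- Consider n ≥ 2 points on a line in the plane not parallel to any of the k sector-boundary directions. Then each of the two extreme points of the line contains all other points within a single one of its k sectors, and every non-extreme point contains the others in exactly two (opposite) k-sectors. Consequently, for every ordering, the k-sector ordered Yao graph on these points has at most 2n − 3 edges. -/

import Mathlib

open Complex
open scoped Classical

/-- `q` lies in the `s`-th of the `k` sectors based at `p`. -/
def InSector (k s : ℕ) (p q : ℂ) : Prop :=
  p ≠ q ∧ ∃ m : ℤ,
    2 * Real.pi * s / k ≤ (q - p).arg + 2 * Real.pi * m ∧
    (q - p).arg + 2 * Real.pi * m < 2 * Real.pi * (s + 1) / k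

/-- The index of the sector, among the `k` sectors at the origin, containing the direction `z`. -/
noncomputable def sectorIndex (k : ℕ) (z : ℂ) : ℕ :=
  (⌊(k : ℝ) * z.arg / (2 * Real.pi)⌋ % (k : ℤ)).toNat

theorem sectorIndex_lt {k : ℕ} (hk : 0 < k) (z : ℂ) : sectorIndex k z < k := by
  have h1 := Int.emod_lt_of_pos ⌊(k : ℝ) * z.arg / (2 * Real.pi)⌋ (Int.natCast_pos.mpr hk)
  unfold sectorIndex
  omega

theorem sectorIndex_eq_iff {k : ℕ} (hk : 0 < k) (z w : ℂ) :
    sectorIndex k z = sectorIndex k w ↔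
      (k : ℤ) ∣ ⌊(k : ℝ) * z.arg / (2 * Real.pi)⌋ - ⌊(k : ℝ) * w.arg / (2 * Real.pi)⌋ := by
  have hk' : (k : ℤ) ≠ 0 := by omega
  rw [← Int.emod_eq_emod_iff_emod_sub_eq_zero.trans Int.dvd_iff_emod_eq_zero.symm]
  have h1 := Int.emod_nonneg ⌊(k : ℝ) * z.arg / (2 * Real.pi)⌋ hk'
  have h2 := Int.emod_nonneg ⌊(k : ℝ) * w.arg / (2 * Real.pi)⌋ hk'
  unfold sectorIndex
  omega

theorem inSector_iff_sectorIndex {k s : ℕ} (hs : s < k) (p q : ℂ) :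
    InSector k s p q ↔ p ≠ q ∧ s = sectorIndex k (q - p) := by
  have hk0 : (0 : ℝ) < k := by exact_mod_cast (Nat.zero_le s).trans_lt hs
  have hpi := Real.pi_pos
  have key : ∀ m : ℤ, (2 * Real.pi * s / k ≤ (q - p).arg + 2 * Real.pi * m ∧
      (q - p).arg + 2 * Real.pi * m < 2 * Real.pi * (s + 1) / k) ↔
      ⌊(k : ℝ) * (q - p).arg / (2 * Real.pi)⌋ + k * m = s := by
    intro m
    have hfloor : ⌊(k : ℝ) * (q - p).arg / (2 * Real.pi)⌋ + k * m =
        ⌊(k : ℝ) * ((q - p).arg + 2 * Real.pi * m) / (2 * Real.pi)⌋ := by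
      rw [← Int.floor_add_intCast]
      congr 1
      push_cast
      field_simp
    rw [hfloor, Int.floor_eq_iff, div_le_iff₀ hk0, lt_div_iff₀ hk0,
      le_div_iff₀ (by positivity), div_lt_iff₀ (by positivity)]
    push_cast
    constructor <;> rintro ⟨h1, h2⟩ <;> constructor <;> linarith
  unfold InSector
  simp only [key]
  refine and_congr_right fun _ => ?_
  unfold sectorIndex
  set N := ⌊(k : ℝ) * (q - p).arg / (2 * Real.pi)⌋
  have h0 := Int.emod_nonneg N (show (k : ℤ) ≠ 0 by omega)
  constructor
  · rintro ⟨m, hm⟩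
    have : N % k = s := by
      rw [← Int.add_mul_emod_self_left N k m, hm]
      exact Int.emod_eq_of_lt (by omega) (by omega)
    omega
  · intro h
    refine ⟨-(N / k), ?_⟩
    have := Int.emod_add_mul_ediv N k
    rw [mul_neg]
    omega

theorem sectorIndex_real_mul (k : ℕ) {r : ℝ} (hr : 0 < r) (z : ℂ) :
    sectorIndex k (r * z) = sectorIndex k z := by
  rw [sectorIndex, sectorIndex, Complex.arg_real_mul z hr]

theorem sectorIndex_ne_of_arg_eq_add_pi {k : ℕ} (hk : 2 ≤ k) {z w : ℂ}
    (h : w.arg = z.arg + Real.pi) : sectorIndex k w ≠ sectorIndex k z := by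
  rw [Ne, sectorIndex_eq_iff (by omega)]
  have hx : (k : ℝ) * w.arg / (2 * Real.pi) = (k : ℝ) * z.arg / (2 * Real.pi) + k / 2 := by
    rw [h]
    field_simp
  rw [hx]
  set x := (k : ℝ) * z.arg / (2 * Real.pi)
  have hk' : (2 : ℝ) ≤ k := by exact_mod_cast hk
  have hpos : 0 < ⌊x + k / 2⌋ - ⌊x⌋ := by
    have : (0 : ℝ) < ((⌊x + k / 2⌋ - ⌊x⌋ : ℤ) : ℝ) := by
      push_cast
      linarith [Int.lt_floor_add_one (x + k / 2), Int.floor_le x]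
    exact_mod_cast this
  have hlt : ⌊x + k / 2⌋ - ⌊x⌋ < (k : ℤ) := by
    have : ((⌊x + k / 2⌋ - ⌊x⌋ : ℤ) : ℝ) < ((k : ℤ) : ℝ) := by
      push_cast
      linarith [Int.floor_le (x + k / 2), Int.lt_floor_add_one x]
    exact_mod_cast this
  exact fun hdvd => absurd (Int.le_of_dvd hpos hdvd) (by omega)

theorem sectorIndex_neg_ne {k : ℕ} (hk : 2 ≤ k) {z : ℂ} (hz : z ≠ 0) :
    sectorIndex k (-z) ≠ sectorIndex k z := by
  rcases le_or_gt z.arg 0 with h | h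
  · by_cases h' : z.arg = 0
    · refine sectorIndex_ne_of_arg_eq_add_pi hk ?_
      obtain ⟨hre, him⟩ := Complex.arg_eq_zero_iff.mp h'
      have hre' : 0 < z.re := lt_of_le_of_ne hre fun h0 => hz (Complex.ext h0.symm him)
      rw [h', zero_add, Complex.arg_eq_pi_iff]
      simp [hre', him]
    · refine sectorIndex_ne_of_arg_eq_add_pi hk (Complex.arg_neg_eq_arg_add_pi_of_im_neg ?_)
      exact Complex.arg_neg_iff.mp (lt_of_le_of_ne h h')
  · refine (sectorIndex_ne_of_arg_eq_add_pi hk ?_).symm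
    have : (-z).arg = z.arg - Real.pi := by
      rw [Complex.arg_neg_eq_arg_sub_pi_iff]
      by_cases him : 0 < z.im
      · exact Or.inl him
      · have him0 : z.im = 0 :=
          le_antisymm (not_lt.mp him) (Complex.arg_nonneg_iff.mp h.le)
        refine Or.inr ⟨him0, ?_⟩
        by_contra hre
        exact h.ne' (Complex.arg_eq_zero_iff.mpr ⟨not_lt.mp hre, him0⟩)
    linarith

/-- Which sectors at a point of a line contain another point of the line. -/
theorem inSector_line_iff {k s : ℕ} (hs : s < k) {a d : ℂ} (hd : d ≠ 0) (x y : ℝ) :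
    InSector k s (a + x * d) (a + y * d) ↔
      (s = sectorIndex k d ∧ x < y) ∨ (s = sectorIndex k (-d) ∧ y < x) := by
  rw [inSector_iff_sectorIndex hs]
  rcases lt_trichotomy x y with h | rfl | h
  · have hsub : a + y * d - (a + x * d) = ((y - x : ℝ) : ℂ) * d := by push_cast; ring
    have hne : a + x * d ≠ a + y * d := by simp [hd, h.ne]
    rw [hsub, sectorIndex_real_mul k (sub_pos.mpr h)]
    simp [h, h.not_gt, hne]
  · simp
  · have hsub : a + y * d - (a + x * d) = ((x - y : ℝ) : ℂ) * -d := by push_cast; ring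
    have hne : a + x * d ≠ a + y * d := by simp [hd, h.ne']
    rw [hsub, sectorIndex_real_mul k (sub_pos.mpr h)]
    simp [h, h.not_gt, hne]

/-- The sectors at a point of a line that contain some point of a family on the line. -/
theorem filter_inSector_line_eq {ι : Type*} {k : ℕ} (hk : 2 ≤ k) {a d : ℂ} (hd : d ≠ 0)
    (t : ι → ℝ) (x : ℝ) (P : ι → Prop)
    [DecidablePred fun s => ∃ j, P j ∧ InSector k s (a + x * d) (a + t j * d)] :
    (Finset.range k).filter (fun s => ∃ j, P j ∧ InSector k s (a + x * d) (a + t j * d)) =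
      (if ∃ j, P j ∧ x < t j then {sectorIndex k d} else ∅) ∪
        (if ∃ j, P j ∧ t j < x then {sectorIndex k (-d)} else ∅) := by
  ext s
  have hdk := sectorIndex_lt (k := k) (by omega) d
  have hndk := sectorIndex_lt (k := k) (by omega) (-d)
  simp only [Finset.mem_filter, Finset.mem_range, Finset.mem_union]
  constructor
  · rintro ⟨hs, j, hj, hin⟩
    rcases (inSector_line_iff hs hd _ _).mp hin with ⟨rfl, h⟩ | ⟨rfl, h⟩
    · left
      rw [if_pos ⟨j, hj, h⟩]
      simp
    · right
      rw [if_pos ⟨j, hj, h⟩]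
      simp
  · rintro (h | h) <;> split_ifs at h with hex
    · obtain ⟨j, hj, hlt⟩ := hex
      obtain rfl := Finset.mem_singleton.mp h
      exact ⟨hdk, j, hj, (inSector_line_iff hdk hd _ _).mpr (Or.inl ⟨rfl, hlt⟩)⟩
    · simp at h
    · obtain ⟨j, hj, hlt⟩ := hex
      obtain rfl := Finset.mem_singleton.mp h
      exact ⟨hndk, j, hj, (inSector_line_iff hndk hd _ _).mpr (Or.inr ⟨rfl, hlt⟩)⟩
    · simp at h

/-- The number of sectors at a point of a line that contain some point of a family on the line. -/
theorem card_filter_inSector_line {ι : Type*} {k : ℕ} (hk : 2 ≤ k) {a d : ℂ} (hd : d ≠ 0)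
    (t : ι → ℝ) (x : ℝ) (P : ι → Prop)
    [DecidablePred fun s => ∃ j, P j ∧ InSector k s (a + x * d) (a + t j * d)] :
    ((Finset.range k).filter
      (fun s => ∃ j, P j ∧ InSector k s (a + x * d) (a + t j * d))).card =
      (if ∃ j, P j ∧ x < t j then 1 else 0) + (if ∃ j, P j ∧ t j < x then 1 else 0) := by
  rw [filter_inSector_line_eq hk hd, Finset.card_union_of_disjoint]
  · split_ifs <;> simp
  · split_ifs <;> simp [(sectorIndex_neg_ne hk hd).symm]

/-- For `n ≥ 2` points on a line not parallel to any of the `k` sector-boundary directions: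
each of the two extreme points contains all other points within a single one of its `k`
sectors, every non-extreme point contains the others in exactly two of its `k`-sectors, and
consequently for every ordering the `k`-sector ordered Yao graph (whose edge count is the
sum over the points of the number of sectors containing a predecessor at insertion time)
has at most `2n − 3` edges. -/
theorem stmt_19 (k n : ℕ) (hk : 2 ≤ k) (hn : 2 ≤ n)
    (a d : ℂ) (hd : d ≠ 0)
    (hnotpar : ∀ j : ℕ, j < k → ∀ r : ℝ,
      d ≠ (r : ℂ) * Complex.exp (2 * Real.pi * j / k * Complex.I))
    (t : Fin n → ℝ) (ht : Function.Injective t)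
    (pts : Fin n → ℂ) (hpts : ∀ i, pts i = a + (t i : ℂ) * d) :
    (∀ i : Fin n, ((∀ j, t j ≤ t i) ∨ (∀ j, t i ≤ t j)) →
      ((Finset.range k).filter
        (fun s => ∃ j : Fin n, j ≠ i ∧ InSector k s (pts i) (pts j))).card = 1) ∧
    (∀ i : Fin n, ¬ ((∀ j, t j ≤ t i) ∨ (∀ j, t i ≤ t j)) →
      ((Finset.range k).filter
        (fun s => ∃ j : Fin n, j ≠ i ∧ InSector k s (pts i) (pts j))).card = 2) ∧
    (Finset.univ.sum fun i : Fin n =>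
      ((Finset.range k).filter
        (fun s => ∃ j : Fin n, j < i ∧ InSector k s (pts i) (pts j))).card) ≤
      2 * n - 3 := by
  obtain rfl : pts = fun i => a + (t i : ℂ) * d := funext hpts
  refine ⟨fun i hi => ?_, fun i hi => ?_, ?_⟩
  · have : Nontrivial (Fin n) := Fin.nontrivial_iff_two_le.mpr hn
    obtain ⟨j, hj⟩ := exists_ne i
    have hne : t j ≠ t i := ht.ne hj
    rw [card_filter_inSector_line hk hd]
    rcases hi with hi | hi
    · rw [if_neg, if_pos ⟨j, hj, lt_of_le_of_ne (hi j) hne⟩]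
      rintro ⟨l, -, hl⟩
      exact (hi l).not_gt hl
    · rw [if_pos ⟨j, hj, lt_of_le_of_ne (hi j) hne.symm⟩, if_neg]
      rintro ⟨l, -, hl⟩
      exact (hi l).not_gt hl
  · push Not at hi
    obtain ⟨⟨j, hj⟩, l, hl⟩ := hi
    rw [card_filter_inSector_line hk hd,
      if_pos ⟨j, fun h => hj.ne (h ▸ rfl), hj⟩, if_pos ⟨l, fun h => hl.ne (h ▸ rfl), hl⟩]
  · obtain ⟨m, rfl⟩ := Nat.exists_eq_add_of_le' hn
    rw [Fin.sum_univ_succ, Fin.sum_univ_succ]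
    have hsum : 2 * (m + 2) - 3 = 0 + (1 + m * 2) := by omega
    rw [hsum]
    refine add_le_add ?_ (add_le_add ?_ ?_)
    · simp
    · have hzero : ∀ j : Fin (m + 2), j < Fin.succ 0 → j = 0 := fun j hj => by
        have : (j : ℕ) < 1 := hj
        exact Fin.ext (by simpa using this)
      rw [card_filter_inSector_line hk hd]
      split_ifs with hp hq
      · obtain ⟨j, hj, hlt⟩ := hp
        obtain ⟨l, hl, hgt⟩ := hq
        rw [hzero j hj] at hlt
        rw [hzero l hl] at hgt
        exact absurd hlt hgt.not_gt
      all_goals simp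
    · refine (Finset.sum_le_card_nsmul _ _ 2 fun i _ => ?_).trans (by simp)
      rw [card_filter_inSector_line hk hd]
      split_ifs <;> simp
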